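/- Let a : ℤ₈×ℤ₇ → ℝ and set B := σ Σ_{i∈ℤ₈, j∈ℤ₇} a_{ij} e_i ⊗ (e_j∧(e⌟Φ) − e∧(e_j⌟Φ)) ∈ (ℝ⁸)*⊗Λ⁴(ℝ⁸)*, where e₇ := e. Define the 5-form dB by dB(x₀,…,x₄) = Σ_{k=0}^{4} (−1)^k (B(x_k))(x₀,…,x̂_k,…,x₄), and the 1-form θ := −(4/7) Σ_{i∈ℤ₇} (a_{i+4,i+5} − a_{i+5,i+4} + a_{i+1,i+3} − a_{i+3,i+1} + a_{i+2,i+6} − a_{i+6,i+2} + σ a_{7,i}) e_i + (4σ/7)(Σ_{i∈ℤ₇} a_{ii}) e. Then dB = θ∧Φ if and only if for all vectors x, y, z ∈ ℝ⁸: 4 r̄(B)(x,y,z) = ⟨x,y⟩θ(z) − ⟨x,z⟩θ(y) + σ Φ(θ♯, x, y, z), where θ♯ is the vector dual to θ. (Pointwise form of Proposition 3.1: the locally conformal parallel condition dΦ = θ⁸∧Φ is equivalent to 4r̄(∇Φ) = Σ_i e_i⊗e_i∧θ⁸ + σθ⁸⌟Φ.) -/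

import Mathlib

open scoped BigOperators RealInnerProductSpace

noncomputable section

abbrev Form (n p : ℕ) := (Fin p → EuclideanSpace ℝ (Fin n)) → ℝ

namespace Form

/-- Wedge product of forms (shuffle convention; full antisymmetrization divided by p!q!). -/
def wedge {n p q : ℕ} (α : Form n p) (β : Form n q) : Form n (p + q) :=
  fun x =>
    (((p.factorial * q.factorial : ℕ) : ℝ))⁻¹ *
      ∑ σ : Equiv.Perm (Fin (p + q)),
        ((Equiv.Perm.sign σ : ℤ) : ℝ) *
          (α fun i => x (σ (Fin.castAdd q i))) * (β fun j => x (σ (Fin.natAdd p j)))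

/-- Inner product of `p`-forms. -/
def inner' {n p : ℕ} (α β : Form n p) : ℝ :=
  ((p.factorial : ℕ) : ℝ)⁻¹ *
    ∑ f : Fin p → Fin n,
      (α fun k => EuclideanSpace.single (f k) 1) * (β fun k => EuclideanSpace.single (f k) 1)

/-- Interior product of a vector and a form. -/
def iprod {n p : ℕ} (v : EuclideanSpace ℝ (Fin n)) (α : Form n (p + 1)) : Form n p :=
  fun x => α (Fin.cons v x)

end Form

infixl:72 " ⋏ " => Form.wedge

/-- The 1-form dual to a vector. -/
def dual {n : ℕ} (v : EuclideanSpace ℝ (Fin n)) : Form n 1 := fun x => ⟪v, x 0⟫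

abbrev E8 := EuclideanSpace ℝ (Fin 8)

/-- The basis vector `e`. -/
def e8 : E8 := EuclideanSpace.single 7 1

/-- The basis vectors `e₀,…,e₆` indexed mod 7. -/
def u7 (i : ZMod 7) : E8 := EuclideanSpace.single ⟨i.val, i.val_lt.trans (by norm_num)⟩ 1

/-- The basis indexed by ℤ₈, with `e₇ = e`. -/
def u8 (i : ZMod 8) : E8 := EuclideanSpace.single ⟨i.val, i.val_lt⟩ 1

/-- The Spin(7) fundamental 4-form. -/
def Phi (σ : ℝ) : Form 8 4 := fun x =>
  (∑ i : ZMod 7, (dual e8 ⋏ dual (u7 i) ⋏ dual (u7 (i + 1)) ⋏ dual (u7 (i + 3))) x)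
    - σ * ∑ i : ZMod 7,
        (dual (u7 (i + 2)) ⋏ dual (u7 (i + 4)) ⋏ dual (u7 (i + 5)) ⋏ dual (u7 (i + 6))) x

/-- The standard volume form of ℝ⁸. -/
def vol8 : Form 8 8 :=
  dual e8 ⋏ dual (u7 0) ⋏ dual (u7 1) ⋏ dual (u7 2) ⋏ dual (u7 3) ⋏ dual (u7 4) ⋏ dual (u7 5)
    ⋏ dual (u7 6)

/-- The 2-forms spanning spin(7)ᗮ. -/
def beta (σ : ℝ) (i : ZMod 7) : Form 8 2 := fun x =>
  σ * (dual (u7 i) ⋏ dual e8) x + (dual (u7 (i + 1)) ⋏ dual (u7 (i + 3))) x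
    + (dual (u7 (i + 4)) ⋏ dual (u7 (i + 5))) x + (dual (u7 (i + 2)) ⋏ dual (u7 (i + 6))) x

/-- The 4-form `y∧(z⌟Φ) − z∧(y⌟Φ)`. -/
def chi (σ : ℝ) (y z : E8) : Form 8 4 := fun w =>
  (dual y ⋏ (Form.iprod z (Phi σ) : Form 8 3)) w - (dual z ⋏ (Form.iprod y (Phi σ) : Form 8 3)) w

/-- The map `r̄`: `r̄(T)(x,y,z) = (1/8)⟨x⌟T, y∧(z⌟Φ) − z∧(y⌟Φ)⟩`. -/
def rbar (σ : ℝ) (T : E8 → Form 8 4) (x y z : E8) : ℝ :=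
  (8 : ℝ)⁻¹ * Form.inner' (T x) (chi σ y z)

/-- `B = σ Σ_{i∈ℤ₈,j∈ℤ₇} a_{ij} e_i ⊗ (e_j∧(e⌟Φ) − e∧(e_j⌟Φ))`. -/
def Btensor (σ : ℝ) (a : ZMod 8 → ZMod 7 → ℝ) : E8 → Form 8 4 := fun x w =>
  σ * ∑ i : ZMod 8, ∑ j : ZMod 7, a i j * ⟪u8 i, x⟫ *
    ((dual (u7 j) ⋏ (Form.iprod e8 (Phi σ) : Form 8 3)) w
      - (dual e8 ⋏ (Form.iprod (u7 j) (Phi σ) : Form 8 3)) w)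

/-- The alternation (exterior derivative) of `B`, a 5-form. -/
def dB (σ : ℝ) (a : ZMod 8 → ZMod 7 → ℝ) : Form 8 5 := fun x =>
  ∑ k : Fin 5, (-1 : ℝ) ^ (k : ℕ) * Btensor σ a (x k) (fun m => x (k.succAbove m))

/-- The natural map `ℤ₇ → ℤ₈`. -/
def c78 (i : ZMod 7) : ZMod 8 := (i.val : ZMod 8)

/-- The Lee form `θ`, as a vector of ℝ⁸. -/
def Theta (σ : ℝ) (a : ZMod 8 → ZMod 7 → ℝ) : E8 :=
  (∑ i : ZMod 7,
    (-(4 / 7) * (a (c78 (i + 4)) (i + 5) - a (c78 (i + 5)) (i + 4) + a (c78 (i + 1)) (i + 3)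
      - a (c78 (i + 3)) (i + 1) + a (c78 (i + 2)) (i + 6) - a (c78 (i + 6)) (i + 2)
      + σ * a 7 i)) • u7 i)
    + ((4 * σ / 7) * ∑ i : ZMod 7, a (c78 i) i) • e8

open Equiv in
theorem sum_perm_succ {E : Type*} [AddCommGroup E] [Module ℝ E] {n : ℕ}
    (α : E [⋀^Fin n]→ₗ[ℝ] ℝ) (f : Fin (n + 1) → ℝ) (x : Fin (n + 1) → E) :
    ∑ τ : Perm (Fin (n + 1)), ((Perm.sign τ : ℤ) : ℝ) * f (τ 0) * α (fun j => x (τ j.succ))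
      = n.factorial * ∑ k : Fin (n + 1), (-1) ^ (k : ℕ) * f k * α (fun j => x (k.succAbove j)) := by
  rw [Finset.univ_perm_fin_succ, Finset.sum_map, Finset.univ_product_univ.symm, Finset.sum_product,
    Finset.mul_sum]
  refine Finset.sum_congr rfl fun k _ => ?_
  have key : ∀ ρ : Perm (Fin n),
      ((Perm.sign (Perm.decomposeFin.symm (k, ρ)) : ℤ) : ℝ) * f (Perm.decomposeFin.symm (k, ρ) 0)
        * α (fun j => x (Perm.decomposeFin.symm (k, ρ) j.succ))
      = (-1) ^ (k : ℕ) * f k * α (fun j => x (k.succAbove j)) := by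
    intro ρ
    have hρ : ((Perm.sign ρ : ℤ) : ℝ) * ((Perm.sign ρ : ℤ) : ℝ) = 1 := by
      rcases Int.units_eq_one_or (Perm.sign ρ) with h | h <;> simp [h]
    rw [Perm.decomposeFin_symm_apply_zero, Perm.decomposeFin.symm_sign]
    cases k using Fin.cases with
    | zero =>
      have h := α.map_perm (fun j => x ((0 : Fin (n + 1)).succAbove j)) ρ
      have h' : (fun j => x (Perm.decomposeFin.symm (0, ρ) j.succ))
          = (fun j => x ((0 : Fin (n + 1)).succAbove j)) ∘ ρ := by
        funext j; simp
      rw [h', h]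
      simp only [Units.smul_def, zsmul_eq_mul, if_true, Fin.val_zero, pow_zero]
      push_cast
      linear_combination (f 0 * α (fun j => x ((0 : Fin (n + 1)).succAbove j))) * hρ
    | succ i =>
      have h := α.map_perm (fun j => x (i.succ.succAbove j)) (i.cycleRange * ρ)
      have h' : (fun j => x (Perm.decomposeFin.symm (i.succ, ρ) j.succ))
          = (fun j => x (i.succ.succAbove j)) ∘ (i.cycleRange * ρ : Perm (Fin n)) := by
        funext j; simp [Fin.succAbove_cycleRange]
      have : n ≠ 0 := by rintro rfl; exact i.elim0
      rw [h', h, Perm.sign_mul, Fin.sign_cycleRange, if_neg (Fin.succ_ne_zero i)]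
      simp only [Units.smul_def, zsmul_eq_mul, Fin.val_succ, pow_succ]
      push_cast
      linear_combination (-(-1) ^ (i : ℕ) * f i.succ * α (fun j => x (i.succ.succAbove j))) * hρ
  simp only [Equiv.coe_toEmbedding]
  rw [Finset.sum_congr rfl fun ρ _ => key ρ, Finset.sum_const, Finset.card_univ,
    Fintype.card_perm, Fintype.card_fin, nsmul_eq_mul]

theorem dual_wedge_three (v : E8) (α : E8 [⋀^Fin 3]→ₗ[ℝ] ℝ) (w : Fin 4 → E8) :
    (dual v ⋏ (α : Form 8 3)) w
      = ∑ k : Fin 4, (-1) ^ (k : ℕ) * ⟪v, w k⟫ * α (fun j => w (k.succAbove j)) := by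
  have h := sum_perm_succ α (fun k => ⟪v, w k⟫) w
  have h6 : (((Nat.factorial 1 * Nat.factorial 3 : ℕ) : ℝ))⁻¹ * (Nat.factorial 3 : ℝ) = 1 := by
    norm_num [Nat.factorial]
  have e : ∀ j : Fin 3, Fin.natAdd 1 j = j.succ := by decide
  have h1 : (dual v ⋏ (α : Form 8 3)) w = (((Nat.factorial 1 * Nat.factorial 3 : ℕ) : ℝ))⁻¹ *
      ∑ τ : Equiv.Perm (Fin 4),
        ((Equiv.Perm.sign τ : ℤ) : ℝ) * ⟪v, w (τ 0)⟫ * α (fun j => w (τ j.succ)) := by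
    simp only [Form.wedge, dual, e]
    rfl
  rw [h1, h, ← mul_assoc, h6, one_mul]

theorem dual_wedge_four (v : E8) (α : E8 [⋀^Fin 4]→ₗ[ℝ] ℝ) (w : Fin 5 → E8) :
    (dual v ⋏ (α : Form 8 4)) w
      = ∑ k : Fin 5, (-1) ^ (k : ℕ) * ⟪v, w k⟫ * α (fun j => w (k.succAbove j)) := by
  have h := sum_perm_succ α (fun k => ⟪v, w k⟫) w
  have h6 : (((Nat.factorial 1 * Nat.factorial 4 : ℕ) : ℝ))⁻¹ * (Nat.factorial 4 : ℝ) = 1 := by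
    norm_num [Nat.factorial]
  have e : ∀ j : Fin 4, Fin.natAdd 1 j = j.succ := by decide
  have h1 : (dual v ⋏ (α : Form 8 4)) w = (((Nat.factorial 1 * Nat.factorial 4 : ℕ) : ℝ))⁻¹ *
      ∑ τ : Equiv.Perm (Fin 5),
        ((Equiv.Perm.sign τ : ℤ) : ℝ) * ⟪v, w (τ 0)⟫ * α (fun j => w (τ j.succ)) := by
    simp only [Form.wedge, dual, e]
    rfl
  rw [h1, h, ← mul_assoc, h6, one_mul]

theorem exists_perm_castSucc {p : ℕ} (ρ : Equiv.Perm (Fin p)) :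
    ∃ π : Equiv.Perm (Fin (p + 1)), Equiv.Perm.sign π = Equiv.Perm.sign ρ ∧
      (∀ i, π i.castSucc = (ρ i).castSucc) ∧ π (Fin.last p) = Fin.last p := by
  refine ⟨finSumFinEquiv.permCongr (Equiv.Perm.sumCongr ρ (1 : Equiv.Perm (Fin 1))), by simp,
    fun i => ?_, ?_⟩
  · have : i.castSucc = finSumFinEquiv (Sum.inl i : Fin p ⊕ Fin 1) := rfl
    rw [Equiv.permCongr_apply, this, Equiv.symm_apply_apply]
    rfl
  · have : Fin.last p = finSumFinEquiv (Sum.inr 0 : Fin p ⊕ Fin 1) := rfl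
    rw [Equiv.permCongr_apply, this, Equiv.symm_apply_apply]
    rfl

/-- The unnormalised antisymmetrization of a form. -/
def altSum {n p : ℕ} (F : Form n p) : Form n p := fun x =>
  ∑ ρ : Equiv.Perm (Fin p), ((Equiv.Perm.sign ρ : ℤ) : ℝ) * F (fun i => x (ρ i))

theorem altSum_dual {n : ℕ} (v : EuclideanSpace ℝ (Fin n)) : altSum (dual v) = dual v := by
  funext x
  simp [altSum, dual]

theorem altSum_wedge_dual {n p : ℕ} (F : Form n p) (v : EuclideanSpace ℝ (Fin n)) :
    altSum F ⋏ dual v = altSum (fun x : Fin (p + 1) → EuclideanSpace ℝ (Fin n) =>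
      F (fun i => x i.castSucc) * ⟪v, x (Fin.last p)⟫) := by
  funext x
  simp only [Form.wedge, altSum, Finset.mul_sum, Finset.sum_mul]
  rw [Finset.sum_comm]
  have hp : (((p.factorial * Nat.factorial 1 : ℕ) : ℝ))⁻¹ * (p.factorial : ℝ) = 1 := by
    have := Nat.factorial_ne_zero p
    simp
    field_simp
  have key : ∀ ρ : Equiv.Perm (Fin p), ∑ τ : Equiv.Perm (Fin (p + 1)),
      (((p.factorial * Nat.factorial 1 : ℕ) : ℝ))⁻¹ * (((Equiv.Perm.sign τ : ℤ) : ℝ) *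
        (((Equiv.Perm.sign ρ : ℤ) : ℝ) * F (fun i => x (τ (Fin.castAdd 1 (ρ i))))) *
        dual v fun j => x (τ (Fin.natAdd p j)))
      = (((p.factorial * Nat.factorial 1 : ℕ) : ℝ))⁻¹ * ∑ τ : Equiv.Perm (Fin (p + 1)),
        ((Equiv.Perm.sign τ : ℤ) : ℝ) *
          (F (fun i => x (τ i.castSucc)) * ⟪v, x (τ (Fin.last p))⟫) := by
    intro ρ
    rw [← Finset.mul_sum]
    congr 1
    obtain ⟨π, hs, h1, h2⟩ := exists_perm_castSucc ρ
    symm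
    rw [← Equiv.sum_comp (Equiv.mulRight π)]
    refine Finset.sum_congr rfl fun τ _ => ?_
    simp only [Equiv.coe_mulRight, Equiv.Perm.mul_apply, h1, h2, Equiv.Perm.sign_mul, hs]
    have e0 : Fin.natAdd p (0 : Fin 1) = Fin.last p := rfl
    have e1 : ∀ i : Fin p, Fin.castAdd 1 i = i.castSucc := fun _ => rfl
    simp only [dual, e0, e1]
    push_cast
    ring
  rw [Finset.sum_congr rfl fun ρ _ => key ρ, Finset.sum_const, Finset.card_univ,
    Fintype.card_perm, Fintype.card_fin, nsmul_eq_mul, ← mul_assoc, mul_comm (p.factorial : ℝ), hp,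
    one_mul]

/-- The form `e_{I 0} ∧ e_{I 1} ∧ e_{I 2} ∧ e_{I 3}`. -/
def basisForm (I : Fin 4 → Fin 8) : E8 [⋀^Fin 4]→ₗ[ℝ] ℝ :=
  Matrix.detRowAlternating.compLinearMap
    (LinearMap.pi fun r => (EuclideanSpace.proj (I r) : E8 →L[ℝ] ℝ).toLinearMap)

theorem basisForm_apply (I : Fin 4 → Fin 8) (x : Fin 4 → E8) :
    basisForm I x = ∑ τ : Equiv.Perm (Fin 4), ((Equiv.Perm.sign τ : ℤ) : ℝ) *
      ∏ r, x (τ r) (I r) := by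
  have : basisForm I x = Matrix.det (Matrix.of fun k r => x k (I r)) := rfl
  rw [this, Matrix.det_apply']
  rfl

theorem wedge_single (i j k l : Fin 8) :
    dual (EuclideanSpace.single i (1 : ℝ)) ⋏ dual (EuclideanSpace.single j (1 : ℝ))
      ⋏ dual (EuclideanSpace.single k (1 : ℝ)) ⋏ dual (EuclideanSpace.single l (1 : ℝ))
      = (basisForm ![i, j, k, l] : Form 8 4) := by
  rw [← altSum_dual (EuclideanSpace.single i (1 : ℝ)), altSum_wedge_dual, altSum_wedge_dual,
    altSum_wedge_dual]
  funext x
  rw [basisForm_apply]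
  refine Finset.sum_congr rfl fun τ _ => ?_
  simp only [dual, EuclideanSpace.inner_single_left, map_one, one_mul, Fin.prod_univ_four]
  rfl

theorem inner'_basisForm (I : Fin 4 → Fin 8) (β : E8 [⋀^Fin 4]→ₗ[ℝ] ℝ) :
    Form.inner' (basisForm I : Form 8 4) β = β fun r => EuclideanSpace.single (I r) 1 := by
  unfold Form.inner'
  have h1 : ∀ f : Fin 4 → Fin 8, basisForm I (fun k => EuclideanSpace.single (f k) 1)
      = ∑ τ : Equiv.Perm (Fin 4), ((Equiv.Perm.sign τ : ℤ) : ℝ) *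
        if f = I ∘ τ.symm then 1 else 0 := by
    intro f
    rw [basisForm_apply]
    refine Finset.sum_congr rfl fun τ _ => ?_
    congr 1
    simp only [PiLp.single_apply, Finset.prod_ite_zero, Finset.prod_const_one]
    congr 1
    refine propext ⟨fun h => ?_, fun h r _ => ?_⟩
    · funext k
      simpa using (h (τ.symm k) (Finset.mem_univ _)).symm
    · simp [h]
  simp only [h1, Finset.sum_mul]
  rw [Finset.sum_comm]
  have h2 : ∀ τ : Equiv.Perm (Fin 4), ∑ f : Fin 4 → Fin 8,
      ((Equiv.Perm.sign τ : ℤ) : ℝ) * (if f = I ∘ τ.symm then 1 else 0) *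
        β (fun k => EuclideanSpace.single (f k) 1)
      = β fun r => EuclideanSpace.single (I r) 1 := by
    intro τ
    have h := β.map_perm (fun r => EuclideanSpace.single (I r) (1 : ℝ)) τ.symm
    simp only [mul_ite, mul_one, mul_zero, ite_mul, zero_mul, Finset.sum_ite_eq', Finset.mem_univ,
      if_true]
    have h' : (fun k => EuclideanSpace.single ((I ∘ τ.symm) k) (1 : ℝ))
        = (fun r => EuclideanSpace.single (I r) (1 : ℝ)) ∘ τ.symm := rfl
    rw [h', h, Equiv.Perm.sign_symm]
    rcases Int.units_eq_one_or (Equiv.Perm.sign τ) with h | h <;> simp [h]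
  rw [Finset.sum_congr rfl fun τ _ => h2 τ, Finset.sum_const, Finset.card_univ,
    Fintype.card_perm, Fintype.card_fin, nsmul_eq_mul, ← mul_assoc, inv_mul_cancel₀, one_mul]
  norm_num [Nat.factorial]

theorem alternatingMap_sum_apply {ι : Type*} {n : ℕ} (s : Finset ι)
    (f : ι → E8 [⋀^Fin n]→ₗ[ℝ] ℝ) (x : Fin n → E8) : (∑ i ∈ s, f i) x = ∑ i ∈ s, f i x := by
  classical
  induction s using Finset.induction_on with
  | empty => simp
  | insert i s hi ih => rw [Finset.sum_insert hi, Finset.sum_insert hi, AlternatingMap.add_apply, ih]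

/-- The position of `e_i`, `i ∈ ℤ₇`, in the standard basis. -/
def idx (i : ZMod 7) : Fin 8 := ⟨i.val, i.val_lt.trans (by norm_num)⟩

theorem u7_eq (i : ZMod 7) : u7 i = EuclideanSpace.single (idx i) 1 := rfl

theorem sum_zmod_seven {M : Type*} [AddCommMonoid M] (f : ZMod 7 → M) :
    ∑ i : ZMod 7, f i = f 0 + f 1 + f 2 + f 3 + f 4 + f 5 + f 6 :=
  Fin.sum_univ_seven f

/-- The fundamental form as an alternating map. -/
def phiAlt (σ : ℝ) : E8 [⋀^Fin 4]→ₗ[ℝ] ℝ :=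
  ∑ i : ZMod 7, basisForm ![7, idx i, idx (i + 1), idx (i + 3)]
    - σ • ∑ i : ZMod 7, basisForm ![idx (i + 2), idx (i + 4), idx (i + 5), idx (i + 6)]

theorem Phi_eq (σ : ℝ) : Phi σ = phiAlt σ := by
  funext x
  simp only [Phi, phiAlt, u7_eq, e8, wedge_single, AlternatingMap.sub_apply,
    AlternatingMap.smul_apply, alternatingMap_sum_apply, smul_eq_mul]

/-- The `2 × 2` minor in columns `i, j`. -/
def minor2 (i j : Fin 8) (x y : Fin 8 → ℝ) : ℝ := x i * y j - x j * y i

/-- The `3 × 3` minor in columns `i, j, k`. -/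
def minor3 (i j k : Fin 8) (x y z : Fin 8 → ℝ) : ℝ :=
  x i * minor2 j k y z - y i * minor2 j k x z + z i * minor2 j k x y

/-- The `4 × 4` minor in columns `i, j, k, l`. -/
def minor4 (i j k l : Fin 8) (x y z w : Fin 8 → ℝ) : ℝ :=
  x i * minor3 j k l y z w - y i * minor3 j k l x z w + z i * minor3 j k l x y w
    - w i * minor3 j k l x y z

theorem basisForm_eq_minor4 (I : Fin 4 → Fin 8) (x : Fin 4 → E8) :
    basisForm I x = minor4 (I 0) (I 1) (I 2) (I 3) (x 0) (x 1) (x 2) (x 3) := by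
  have : basisForm I x = Matrix.det (Matrix.of fun k r => x k (I r)) := rfl
  rw [this, Matrix.det_succ_column_zero]
  simp [Fin.sum_univ_succ, Matrix.det_fin_three, minor4, minor3, minor2, Fin.succAbove]
  ring

/-- The fundamental form as a polynomial in coordinates. -/
def phiPoly (σ : ℝ) (x y z w : Fin 8 → ℝ) : ℝ :=
  (minor4 7 0 1 3 x y z w + minor4 7 1 2 4 x y z w + minor4 7 2 3 5 x y z w
    + minor4 7 3 4 6 x y z w + minor4 7 4 5 0 x y z w + minor4 7 5 6 1 x y z w
    + minor4 7 6 0 2 x y z w)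
  - σ * (minor4 2 4 5 6 x y z w + minor4 3 5 6 0 x y z w + minor4 4 6 0 1 x y z w
    + minor4 5 0 1 2 x y z w + minor4 6 1 2 3 x y z w + minor4 0 2 3 4 x y z w
    + minor4 1 3 4 5 x y z w)

theorem phiAlt_apply (σ : ℝ) (x : Fin 4 → E8) :
    phiAlt σ x = phiPoly σ (x 0) (x 1) (x 2) (x 3) := by
  simp only [phiAlt, AlternatingMap.sub_apply, AlternatingMap.smul_apply, alternatingMap_sum_apply,
    smul_eq_mul, basisForm_eq_minor4]
  simp only [sum_zmod_seven]
  rfl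

theorem iprod_alternatingMap (α : E8 [⋀^Fin 4]→ₗ[ℝ] ℝ) (v : E8) :
    (Form.iprod v (α : Form 8 4) : Form 8 3) = α.curryLeft v := rfl

theorem curryLeft_eq_cons (α : E8 [⋀^Fin 4]→ₗ[ℝ] ℝ) (v : E8) (x : Fin 3 → E8) :
    α.curryLeft v x = α (Fin.cons v x) := rfl

theorem chi_apply (σ : ℝ) (y z : E8) (w : Fin 4 → E8) : chi σ y z w =
    ∑ k : Fin 4, (-1) ^ (k : ℕ) * (⟪y, w k⟫ * phiAlt σ (Fin.cons z fun j => w (k.succAbove j))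
      - ⟪z, w k⟫ * phiAlt σ (Fin.cons y fun j => w (k.succAbove j))) := by
  simp only [chi, Phi_eq, iprod_alternatingMap, dual_wedge_three, ← Finset.sum_sub_distrib,
    curryLeft_eq_cons]
  exact Finset.sum_congr rfl fun k _ => by ring

theorem chi_eq_phiAlt (σ : ℝ) (y z : E8) (w : Fin 4 → E8) : chi σ y z w =
    (⟪y, w 0⟫ * phiAlt σ ![z, w 1, w 2, w 3] - ⟪y, w 1⟫ * phiAlt σ ![z, w 0, w 2, w 3]
      + ⟪y, w 2⟫ * phiAlt σ ![z, w 0, w 1, w 3] - ⟪y, w 3⟫ * phiAlt σ ![z, w 0, w 1, w 2])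
    - (⟪z, w 0⟫ * phiAlt σ ![y, w 1, w 2, w 3] - ⟪z, w 1⟫ * phiAlt σ ![y, w 0, w 2, w 3]
      + ⟪z, w 2⟫ * phiAlt σ ![y, w 0, w 1, w 3] - ⟪z, w 3⟫ * phiAlt σ ![y, w 0, w 1, w 2]) := by
  have h0 : (fun j => w ((0 : Fin 4).succAbove j)) = ![w 1, w 2, w 3] := by
    funext j; fin_cases j <;> rfl
  have h1 : (fun j => w ((1 : Fin 4).succAbove j)) = ![w 0, w 2, w 3] := by
    funext j; fin_cases j <;> rfl
  have h2 : (fun j => w ((2 : Fin 4).succAbove j)) = ![w 0, w 1, w 3] := by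
    funext j; fin_cases j <;> rfl
  have h3 : (fun j => w ((3 : Fin 4).succAbove j)) = ![w 0, w 1, w 2] := by
    funext j; fin_cases j <;> rfl
  rw [chi_apply, Fin.sum_univ_four, h0, h1, h2, h3]
  simp only [show ∀ v a b c : E8, (Fin.cons v ![a, b, c] : Fin 4 → E8) = ![v, a, b, c] from
    fun _ _ _ _ => rfl]
  norm_num
  ring

/-- The combination of the values of `F` given by the coefficients of
`e_l ∧ (e ⌟ Φ) - e ∧ (e_l ⌟ Φ)`, where `i, j, k, m, n, p, q` are the positions of
`e_l, …, e_{l+6}`. -/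
def chiSum {R M : Type*} [Ring R] [AddCommGroup M] [Module R M] (σ : R) (i j k m n p q : Fin 8)
    (F : Fin 8 → Fin 8 → Fin 8 → Fin 8 → M) : M :=
  F i j k n + F i k m p + F i m n q + F i p q j
    + σ • (F m p q 7 - F j n q 7 + F j k p 7 - F k m n 7)

theorem map_chiSum {R M N : Type*} [Ring R] [AddCommGroup M] [Module R M] [AddCommGroup N]
    [Module R N] (f : M →ₗ[R] N) (σ : R) (i j k m n p q : Fin 8)
    (F : Fin 8 → Fin 8 → Fin 8 → Fin 8 → M) :
    f (chiSum σ i j k m n p q F) = chiSum σ i j k m n p q fun a b c d => f (F a b c d) := by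
  simp [chiSum]

/-- `chiSum` at the columns of `e_l, …, e_{l+6}`. -/
def chiSumAt {R M : Type*} [Ring R] [AddCommGroup M] [Module R M] (σ : R) (l : ZMod 7)
    (F : Fin 8 → Fin 8 → Fin 8 → Fin 8 → M) : M :=
  chiSum σ (idx l) (idx (l + 1)) (idx (l + 2)) (idx (l + 3)) (idx (l + 4)) (idx (l + 5))
    (idx (l + 6)) F

theorem map_chiSumAt {R M N : Type*} [Ring R] [AddCommGroup M] [Module R M] [AddCommGroup N]
    [Module R N] (f : M →ₗ[R] N) (σ : R) (l : ZMod 7) (F : Fin 8 → Fin 8 → Fin 8 → Fin 8 → M) :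
    f (chiSumAt σ l F) = chiSumAt σ l fun a b c d => f (F a b c d) :=
  map_chiSum ..

/-- `e_l ∧ (e ⌟ Φ) - e ∧ (e_l ⌟ Φ)` as an alternating map. -/
def chiAlt (σ : ℝ) (l : ZMod 7) : E8 [⋀^Fin 4]→ₗ[ℝ] ℝ :=
  chiSumAt σ l fun a b c d => basisForm ![a, b, c, d]

theorem chiAlt_apply (σ : ℝ) (l : ZMod 7) (w : Fin 4 → E8) : chiAlt σ l w =
    chiSumAt σ l fun a b c d => minor4 a b c d (w 0) (w 1) (w 2) (w 3) := by
  simp only [chiAlt, chiSumAt, chiSum, AlternatingMap.add_apply, AlternatingMap.sub_apply,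
    AlternatingMap.smul_apply, basisForm_eq_minor4, Matrix.cons_val]

/-- The coordinate expression of `beta`, where `i, j, k, m, n, p, q` are the columns of
`e_l, …, e_{l+6}`. -/
def betaCols (σ : ℝ) (i j k m n p q : Fin 8) (x t : Fin 8 → ℝ) : ℝ :=
  σ * minor2 i 7 x t + minor2 j m x t + minor2 n p x t + minor2 k q x t

/-- The coordinate expression of `beta`. -/
def betaPoly (σ : ℝ) (l : ZMod 7) : (Fin 8 → ℝ) → (Fin 8 → ℝ) → ℝ :=
  betaCols σ (idx l) (idx (l + 1)) (idx (l + 2)) (idx (l + 3)) (idx (l + 4)) (idx (l + 5))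
      (idx (l + 6))

theorem inner_single (i : Fin 8) (x : E8) : ⟪(EuclideanSpace.single i 1 : E8), x⟫ = x i := by
  simp [EuclideanSpace.inner_single_left]

theorem single_ofLp (i j : Fin 8) : (EuclideanSpace.single i 1 : E8) j = if j = i then 1 else 0 := by
  simp [PiLp.single_apply]

theorem minor4_sort_one {i j : Fin 8} (_ : j < i) (k l : Fin 8) (a b c d : Fin 8 → ℝ) :
    minor4 i j k l a b c d = -minor4 j i k l a b c d := by
  simp only [minor4, minor3, minor2]; ring

theorem minor4_sort_two {j k : Fin 8} (_ : k < j) (i l : Fin 8) (a b c d : Fin 8 → ℝ) :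
    minor4 i j k l a b c d = -minor4 i k j l a b c d := by
  simp only [minor4, minor3, minor2]; ring

theorem minor4_sort_three {k l : Fin 8} (_ : l < k) (i j : Fin 8) (a b c d : Fin 8 → ℝ) :
    minor4 i j k l a b c d = -minor4 i j l k a b c d := by
  simp only [minor4, minor3, minor2]; ring

theorem minor4_self_one (i k l : Fin 8) (a b c d : Fin 8 → ℝ) : minor4 i i k l a b c d = 0 := by
  simp only [minor4, minor3, minor2]; ring

theorem minor4_self_two (i k l : Fin 8) (a b c d : Fin 8 → ℝ) : minor4 i k k l a b c d = 0 := by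
  simp only [minor4, minor3, minor2]; ring

theorem minor4_self_three (i k l : Fin 8) (a b c d : Fin 8 → ℝ) : minor4 i k l l a b c d = 0 := by
  simp only [minor4, minor3, minor2]; ring

/-- The wedge product of the `p`-th coordinate with the contraction of a 4-form with `t`. -/
def wedgeContract (p : Fin 8) (t a b c d : Fin 8 → ℝ)
    (F : (Fin 8 → ℝ) → (Fin 8 → ℝ) → (Fin 8 → ℝ) → (Fin 8 → ℝ) → ℝ) : ℝ :=
  a p * F t b c d - b p * F t a c d + c p * F t a b d - d p * F t a b c

theorem wedgeContract_minor4 (p i j k l : Fin 8) (t a b c d : Fin 8 → ℝ) :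
    wedgeContract p t a b c d (minor4 i j k l) = t i * minor4 p j k l a b c d
      + t j * minor4 i p k l a b c d + t k * minor4 i j p l a b c d
      + t l * minor4 i j k p a b c d := by
  simp only [wedgeContract, minor4, minor3, minor2]; ring

theorem wedgeContract_phiPoly (σ : ℝ) (p : Fin 8) (t a b c d : Fin 8 → ℝ) :
    wedgeContract p t a b c d (phiPoly σ) =
  (wedgeContract p t a b c d (minor4 7 0 1 3) + wedgeContract p t a b c d (minor4 7 1 2 4)
    + wedgeContract p t a b c d (minor4 7 2 3 5)
    + wedgeContract p t a b c d (minor4 7 3 4 6) + wedgeContract p t a b c d (minor4 7 4 5 0)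
    + wedgeContract p t a b c d (minor4 7 5 6 1)
    + wedgeContract p t a b c d (minor4 7 6 0 2))
  - σ * (wedgeContract p t a b c d (minor4 2 4 5 6) + wedgeContract p t a b c d (minor4 3 5 6 0)
    + wedgeContract p t a b c d (minor4 4 6 0 1)
    + wedgeContract p t a b c d (minor4 5 0 1 2) + wedgeContract p t a b c d (minor4 6 1 2 3)
    + wedgeContract p t a b c d (minor4 0 2 3 4)
    + wedgeContract p t a b c d (minor4 1 3 4 5)) := by
  simp only [wedgeContract, phiPoly]; ring

theorem chi_eq_sum_wedgeContract (σ : ℝ) (y z : E8) (w : Fin 4 → E8) : chi σ y z w =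
    ∑ p, (y p * wedgeContract p z (w 0) (w 1) (w 2) (w 3) (phiPoly σ)
      - z p * wedgeContract p y (w 0) (w 1) (w 2) (w 3) (phiPoly σ)) := by
  have h (v : E8) : ⟪y, v⟫ = ∑ p, y p * v p ∧ ⟪z, v⟫ = ∑ p, z p * v p := by
    simp [PiLp.inner_apply, mul_comm]
  rw [chi_eq_phiAlt]
  simp only [phiAlt_apply, Matrix.cons_val, h, Finset.sum_mul, ← Finset.sum_sub_distrib,
    ← Finset.sum_add_distrib, wedgeContract]
  exact Finset.sum_congr rfl fun p _ => by ring

set_option maxRecDepth 20000 in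
set_option maxHeartbeats 4000000 in
theorem chi_eq_sum_beta {σ : ℝ} (hσ : σ = 1 ∨ σ = -1) (x t : E8) (w : Fin 4 → E8) :
    chi σ x t w = σ * ∑ l, betaPoly σ l x t * chiAlt σ l w := by
  simp only [chi_eq_sum_wedgeContract, chiAlt_apply]
  generalize (w 0).ofLp = a, (w 1).ofLp = b, (w 2).ofLp = c, (w 3).ofLp = d
  generalize x.ofLp = x, t.ofLp = t
  rw [Fin.sum_univ_eight, sum_zmod_seven]
  let F (i j k l : Fin 8) := minor4 i j k l a b c d
  change _ = σ * (
      betaCols σ 0 1 2 3 4 5 6 x t * chiSum σ 0 1 2 3 4 5 6 F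
      + betaCols σ 1 2 3 4 5 6 0 x t * chiSum σ 1 2 3 4 5 6 0 F
      + betaCols σ 2 3 4 5 6 0 1 x t * chiSum σ 2 3 4 5 6 0 1 F
      + betaCols σ 3 4 5 6 0 1 2 x t * chiSum σ 3 4 5 6 0 1 2 F
      + betaCols σ 4 5 6 0 1 2 3 x t * chiSum σ 4 5 6 0 1 2 3 F
      + betaCols σ 5 6 0 1 2 3 4 x t * chiSum σ 5 6 0 1 2 3 4 F
      + betaCols σ 6 0 1 2 3 4 5 x t * chiSum σ 6 0 1 2 3 4 5 F)
  simp only [wedgeContract_phiPoly, wedgeContract_minor4, betaCols, chiSum, minor2, F, smul_eq_mul]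
  simp (discharger := decide) only [minor4_self_one, minor4_self_two, minor4_self_three,
    minor4_sort_one, minor4_sort_two, minor4_sort_three]
  rcases hσ with rfl | rfl <;> ring

theorem sum_beta_mul_beta {σ : ℝ} (hσ : σ = 1 ∨ σ = -1) (x t y z : E8) :
    ∑ l, betaPoly σ l x t * betaPoly σ l y z
      = ⟪x, y⟫ * ⟪t, z⟫ - ⟪x, z⟫ * ⟪t, y⟫ + σ * phiAlt σ ![t, x, y, z] := by
  rw [phiAlt_apply]
  simp only [PiLp.inner_apply, Fin.sum_univ_eight, Matrix.cons_val, sum_zmod_seven,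
    RCLike.inner_apply, conj_trivial]
  generalize x.ofLp = x, t.ofLp = t, y.ofLp = y, z.ofLp = z
  change betaCols σ 0 1 2 3 4 5 6 x t * betaCols σ 0 1 2 3 4 5 6 y z
    + betaCols σ 1 2 3 4 5 6 0 x t * betaCols σ 1 2 3 4 5 6 0 y z
    + betaCols σ 2 3 4 5 6 0 1 x t * betaCols σ 2 3 4 5 6 0 1 y z
    + betaCols σ 3 4 5 6 0 1 2 x t * betaCols σ 3 4 5 6 0 1 2 y z
    + betaCols σ 4 5 6 0 1 2 3 x t * betaCols σ 4 5 6 0 1 2 3 y z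
    + betaCols σ 5 6 0 1 2 3 4 x t * betaCols σ 5 6 0 1 2 3 4 y z
    + betaCols σ 6 0 1 2 3 4 5 x t * betaCols σ 6 0 1 2 3 4 5 y z = _
  simp only [betaCols, phiPoly, minor4, minor3, minor2]
  rcases hσ with rfl | rfl <;> ring

theorem idx_ne_seven (l : ZMod 7) : idx l ≠ 7 := by
  revert l; decide

theorem idx_injective : Function.Injective idx := by
  decide

theorem betaPoly_u7_e8 (σ : ℝ) (m l : ZMod 7) :
    betaPoly σ m (u7 l) e8 = if m = l then σ else 0 := by
  simp [betaPoly, betaCols, minor2, u7_eq, e8, idx_ne_seven, (idx_ne_seven _).symm,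
    idx_injective.eq_iff]

theorem chi_u7_e8 {σ : ℝ} (hσ : σ = 1 ∨ σ = -1) (l : ZMod 7) (w : Fin 4 → E8) :
    chi σ (u7 l) e8 w = chiAlt σ l w := by
  rw [chi_eq_sum_beta hσ]
  rcases hσ with rfl | rfl <;> simp [betaPoly_u7_e8]

/-- `minor2` at standard basis vectors, for distinct columns. -/
def minor2Z (i j a b : Fin 8) : ℤ :=
  if a = i then if b = j then 1 else 0 else if b = i then if a = j then -1 else 0 else 0

/-- `minor3` at standard basis vectors, for distinct columns. -/
def minor3Z (i j k a b c : Fin 8) : ℤ :=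
  if a = i then minor2Z j k b c else if b = i then minor2Z j k c a else
     if c = i then minor2Z j k a b else 0

/-- `minor4` at standard basis vectors, for distinct columns. -/
def minor4Z (i j k l a b c d : Fin 8) : ℤ :=
  if a = i then minor3Z j k l b c d else if b = i then minor3Z j k l a d c else
    if c = i then minor3Z j k l a b d else if d = i then minor3Z j k l a c b else 0

/-- `chiAlt` at standard basis vectors. -/
def chiZ (s : ℤ) (l : ZMod 7) (a b c d : Fin 8) : ℤ :=
  chiSumAt s l fun i j k m => minor4Z i j k m a b c d

/-- `betaPoly` at standard basis vectors. -/
def betaZ (s : ℤ) (l : ZMod 7) (a b : Fin 8) : ℤ :=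
  s * minor2Z (idx l) 7 a b + minor2Z (idx (l + 1)) (idx (l + 3)) a b
    + minor2Z (idx (l + 4)) (idx (l + 5)) a b + minor2Z (idx (l + 2)) (idx (l + 6)) a b

/-- The wedge product of `e_p` and `chiAlt` at standard basis vectors. -/
def wedgeChiZ (s : ℤ) (p : Fin 8) (q : ZMod 7) (i a b c d : Fin 8) : ℤ :=
  (if i = p then chiZ s q a b c d else 0) - (if a = p then chiZ s q i b c d else 0)
    + (if b = p then chiZ s q i a c d else 0) - (if c = p then chiZ s q i a b d else 0)
    + if d = p then chiZ s q i a b c else 0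

theorem chiSumAt_chiZ : ∀ s ∈ [(1 : ℤ), -1], ∀ l m : ZMod 7,
    chiSumAt s l (chiZ s m) = if l = m then 8 else 0 := by
  decide +kernel

theorem sum_betaZ_mul_betaZ : ∀ s ∈ [(1 : ℤ), -1], ∀ m n : Fin 8,
    ∑ i, ∑ l, betaZ s l i m * betaZ s l i n = if m = n then 7 else 0 := by
  decide +kernel

theorem chiSumAt_wedgeChiZ : ∀ s ∈ [(1 : ℤ), -1], ∀ (i p : Fin 8) (l q : ZMod 7),
    chiSumAt s l (wedgeChiZ s p q i)
      = 2 * (if i = p ∧ l = q then 1 else 0) + 2 * ∑ m, betaZ s l i m * betaZ s q p m := by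
  decide +kernel

/-- The `i`-th standard basis vector. -/
abbrev basisVec (i : Fin 8) : E8 := EuclideanSpace.single i 1

theorem minor2_basisVec {i j : Fin 8} (h : i ≠ j) (a b : Fin 8) :
    minor2 i j (basisVec a) (basisVec b) = minor2Z i j a b := by
  simp only [minor2, minor2Z, single_ofLp, eq_comm (b := i), eq_comm (b := j)]
  split_ifs <;> simp_all

theorem minor3_basisVec {i j k : Fin 8} (h : i ≠ j ∧ i ≠ k ∧ j ≠ k) (a b c : Fin 8) :
    minor3 i j k (basisVec a) (basisVec b) (basisVec c) = minor3Z i j k a b c := by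
  obtain ⟨hij, hik, hjk⟩ := h
  simp only [minor3, minor3Z, minor2_basisVec hjk, single_ofLp, eq_comm (a := i)]
  split_ifs <;> simp_all [minor2Z]
  all_goals split_ifs <;> simp_all

theorem minor4_basisVec {i j k l : Fin 8} (h : i ≠ j ∧ i ≠ k ∧ i ≠ l)
    (h' : j ≠ k ∧ j ≠ l ∧ k ≠ l) (a b c d : Fin 8) :
    minor4 i j k l (basisVec a) (basisVec b) (basisVec c) (basisVec d)
      = minor4Z i j k l a b c d := by
  obtain ⟨hij, hik, hil⟩ := h
  have h0 (b c : Fin 8) : minor3Z j k l i b c = 0 ∧ minor3Z j k l b i c = 0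
      ∧ minor3Z j k l b c i = 0 := by
    simp [minor3Z, minor2Z, hij, hik, hil]
  have hs (b c d : Fin 8) : minor3Z j k l b d c = -minor3Z j k l b c d := by
    obtain ⟨hjk, hjl, hkl⟩ := h'
    simp only [minor3Z, minor2Z]
    split_ifs <;> simp_all
  rw [minor4Z, hs a c d, hs a b c]
  simp only [minor4, minor3_basisVec h', single_ofLp, eq_comm (a := i)]
  clear hs
  split_ifs <;> simp_all

theorem chiAlt_basisVec (s : ℤ) (l : ZMod 7) (a b c d : Fin 8) :
    chiAlt s l ![basisVec a, basisVec b, basisVec c, basisVec d] = chiZ s l a b c d := by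
  have h (m n : ZMod 7) (hmn : m ≠ n) : idx (l + m) ≠ idx (l + n) := by
    simpa [idx_injective.eq_iff] using hmn
  have h' (m : ZMod 7) (hm : 0 ≠ m) : idx l ≠ idx (l + m) := by
    simpa using h 0 m hm
  rw [chiAlt_apply]
  simp only [chiSumAt, chiSum, chiZ, Matrix.cons_val, smul_eq_mul]
  push_cast
  simp (discharger := first | decide | exact idx_ne_seven _ |
    (refine ⟨?_, ?_, ?_⟩ <;> first | exact idx_ne_seven _ | exact h' _ (by decide) |
      exact (h' _ (by decide)).symm | exact h _ _ (by decide))) only [minor4_basisVec]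

theorem inner'_chiAlt (σ : ℝ) (l : ZMod 7) (β : E8 [⋀^Fin 4]→ₗ[ℝ] ℝ) :
    Form.inner' (chiAlt σ l : Form 8 4) β
      = chiSumAt σ l fun a b c d => β ![basisVec a, basisVec b, basisVec c, basisVec d] := by
  let L : (E8 [⋀^Fin 4]→ₗ[ℝ] ℝ) →ₗ[ℝ] ℝ :=
    { toFun := fun α => Form.inner' (α : Form 8 4) β
      map_add' := fun α γ => by
        simp [Form.inner', add_mul, mul_add, Finset.sum_add_distrib]
      map_smul' := fun r α => by
        simp only [Form.inner', AlternatingMap.smul_apply, smul_eq_mul, Finset.mul_sum,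
          RingHom.id_apply]
        exact Finset.sum_congr rfl fun _ _ => by ring }
  have h : L (chiAlt σ l) = _ := map_chiSumAt L σ l _
  refine h.trans (congrArg _ ?_)
  funext a b c d
  refine (inner'_basisForm _ β).trans (congrArg β ?_)
  funext r
  fin_cases r <;> rfl

theorem exists_int_sign {σ : ℝ} (hσ : σ = 1 ∨ σ = -1) : ∃ s ∈ [(1 : ℤ), -1], σ = s := by
  rcases hσ with rfl | rfl
  · exact ⟨1, by simp, by simp⟩
  · exact ⟨-1, by simp, by simp⟩

theorem inner'_chiAlt_chiAlt {σ : ℝ} (hσ : σ = 1 ∨ σ = -1) (l m : ZMod 7) :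
    Form.inner' (chiAlt σ l : Form 8 4) (chiAlt σ m) = if l = m then 8 else 0 := by
  obtain ⟨s, hs, rfl⟩ := exists_int_sign hσ
  have h := chiSumAt_chiZ s hs l m
  rw [inner'_chiAlt]
  simp only [chiAlt_basisVec]
  rw [← Int.cast_inj (α := ℝ)] at h
  simpa [chiSumAt, chiSum] using h

theorem inner'_sum {ι : Type*} [Fintype ι] {n p : ℕ} (u v : ι → ℝ) (F G : ι → Form n p) :
    Form.inner' (fun w => ∑ l, u l * F l w) (fun w => ∑ m, v m * G m w)
      = ∑ l, ∑ m, u l * v m * Form.inner' (F l) (G m) := by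
  simp only [Form.inner', Finset.sum_mul_sum]
  rw [Finset.sum_comm, Finset.mul_sum]
  refine Finset.sum_congr rfl fun l _ => ?_
  rw [Finset.sum_comm, Finset.mul_sum]
  refine Finset.sum_congr rfl fun m _ => ?_
  simp only [Finset.mul_sum]
  exact Finset.sum_congr rfl fun f _ => by ring

/-- The 1-form `∑ i, a i l • e_i`. -/
def coordForm (a : ZMod 8 → ZMod 7 → ℝ) (l : ZMod 7) (x : Fin 8 → ℝ) : ℝ :=
  ∑ i : Fin 8, a i l * x i

theorem Btensor_eq {σ : ℝ} (hσ : σ = 1 ∨ σ = -1) (a : ZMod 8 → ZMod 7 → ℝ) (x : E8) :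
    Btensor σ a x = fun w => σ * ∑ l, coordForm a l x * chiAlt σ l w := by
  funext w
  have h (i : ZMod 8) : ⟪u8 i, x⟫ = x (i : Fin 8) := inner_single i x
  simp only [Btensor, h]
  rw [Finset.sum_comm]
  congr 1
  refine Finset.sum_congr rfl fun l _ => ?_
  rw [coordForm, Finset.sum_mul]
  refine Finset.sum_congr rfl fun i _ => ?_
  rw [← chi_u7_e8 hσ]
  rfl

theorem rbar_Btensor {σ : ℝ} (hσ : σ = 1 ∨ σ = -1) (a : ZMod 8 → ZMod 7 → ℝ) (x y z : E8) :
    rbar σ (Btensor σ a) x y z = ∑ l, coordForm a l x * betaPoly σ l y z := by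
  have hσ2 : σ * σ = 1 := by rcases hσ with rfl | rfl <;> norm_num
  have h (u v : ZMod 7 → ℝ) : Form.inner' (fun w => ∑ l, u l * chiAlt σ l w)
      (fun w => ∑ m, v m * chiAlt σ m w) = 8 * ∑ l, u l * v l := by
    simp [inner'_sum, inner'_chiAlt_chiAlt hσ, Finset.mul_sum, mul_comm]
  have hchi : chi σ y z = fun w => ∑ l, (σ * betaPoly σ l y z) * chiAlt σ l w := by
    funext w
    simp only [chi_eq_sum_beta hσ, Finset.mul_sum, mul_assoc]
  have hB : Btensor σ a x = fun w => ∑ l, (σ * coordForm a l x) * chiAlt σ l w := by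
    simp only [Btensor_eq hσ, Finset.mul_sum, mul_assoc]
  rw [rbar, hchi, hB, h, ← mul_assoc, inv_mul_cancel₀ (by norm_num), one_mul]
  exact Finset.sum_congr rfl fun l _ => by
    linear_combination coordForm a l x * betaPoly σ l y z * hσ2

theorem rbar_iff {σ : ℝ} (hσ : σ = 1 ∨ σ = -1) (a : ZMod 8 → ZMod 7 → ℝ) (t : E8) :
    (∀ x y z : E8, 4 * rbar σ (Btensor σ a) x y z
        = ⟪x, y⟫ * ⟪t, z⟫ - ⟪x, z⟫ * ⟪t, y⟫ + σ * Phi σ ![t, x, y, z])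
      ↔ ∀ (x : E8) (l : ZMod 7), 4 * coordForm a l x = betaPoly σ l x t := by
  simp only [rbar_Btensor hσ, Phi_eq, ← sum_beta_mul_beta hσ, Finset.mul_sum, ← mul_assoc]
  refine ⟨fun h x l => ?_, fun h x y z => by simp only [h]⟩
  have hσ0 : σ ≠ 0 := by rcases hσ with rfl | rfl <;> norm_num
  simpa [betaPoly_u7_e8, hσ0] using h x (u7 l) e8

theorem alternatingMap_swap_zero_one (α : E8 [⋀^Fin 4]→ₗ[ℝ] ℝ) (a b c d : E8) :
    α ![b, a, c, d] = -α ![a, b, c, d] := by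
  rw [← α.map_swap _ (show (0 : Fin 4) ≠ 1 by decide)]
  congr 1
  funext r
  fin_cases r <;> rfl

theorem alternatingMap_swap_one_two (α : E8 [⋀^Fin 4]→ₗ[ℝ] ℝ) (a b c d : E8) :
    α ![a, c, b, d] = -α ![a, b, c, d] := by
  rw [← α.map_swap _ (show (1 : Fin 4) ≠ 2 by decide)]
  congr 1
  funext r
  fin_cases r <;> rfl

theorem alternatingMap_swap_two_three (α : E8 [⋀^Fin 4]→ₗ[ℝ] ℝ) (a b c d : E8) :
    α ![a, b, d, c] = -α ![a, b, c, d] := by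
  rw [← α.map_swap _ (show (2 : Fin 4) ≠ 3 by decide)]
  congr 1
  funext r
  fin_cases r <;> rfl

/-- The alternating sum over the five ways of moving one of five vectors to the front. -/
theorem sum_fin_five_succAbove {V : Type*} (x : Fin 5 → V) (F : V → (Fin 4 → V) → ℝ) :
    ∑ k : Fin 5, (-1) ^ (k : ℕ) * F (x k) (fun j => x (k.succAbove j))
      = F (x 0) ![x 1, x 2, x 3, x 4] - F (x 1) ![x 0, x 2, x 3, x 4]
        + F (x 2) ![x 0, x 1, x 3, x 4] - F (x 3) ![x 0, x 1, x 2, x 4]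
        + F (x 4) ![x 0, x 1, x 2, x 3] := by
  have h0 : (fun j => x ((0 : Fin 5).succAbove j)) = ![x 1, x 2, x 3, x 4] := by
    funext j; fin_cases j <;> rfl
  have h1 : (fun j => x ((1 : Fin 5).succAbove j)) = ![x 0, x 2, x 3, x 4] := by
    funext j; fin_cases j <;> rfl
  have h2 : (fun j => x ((2 : Fin 5).succAbove j)) = ![x 0, x 1, x 3, x 4] := by
    funext j; fin_cases j <;> rfl
  have h3 : (fun j => x ((3 : Fin 5).succAbove j)) = ![x 0, x 1, x 2, x 4] := by
    funext j; fin_cases j <;> rfl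
  have h4 : (fun j => x ((4 : Fin 5).succAbove j)) = ![x 0, x 1, x 2, x 3] := by
    funext j; fin_cases j <;> rfl
  rw [Fin.sum_univ_five, h0, h1, h2, h3, h4]
  norm_num
  ring

theorem sum_chi_succAbove (σ : ℝ) (t : E8) (x : Fin 5 → E8) :
    ∑ k : Fin 5, (-1) ^ (k : ℕ) * chi σ (x k) t (fun j => x (k.succAbove j))
      = 4 * (dual t ⋏ Phi σ) x := by
  rw [Phi_eq, dual_wedge_four]
  simp only [mul_assoc]
  rw [sum_fin_five_succAbove x fun y w => chi σ y t w,
    sum_fin_five_succAbove x fun y w => ⟪t, y⟫ * phiAlt σ w]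
  generalize x 0 = a, x 1 = b, x 2 = c, x 3 = d, x 4 = f
  have h1 := alternatingMap_swap_zero_one (phiAlt σ)
  have h2 (a b c d : E8) : phiAlt σ ![c, a, b, d] = phiAlt σ ![a, b, c, d] := by
    rw [h1, alternatingMap_swap_one_two, neg_neg]
  have h3 (a b c d : E8) : phiAlt σ ![d, a, b, c] = -phiAlt σ ![a, b, c, d] := by
    rw [h2, alternatingMap_swap_two_three]
  simp only [chi_eq_phiAlt, Matrix.cons_val, real_inner_comm b a, real_inner_comm c a,
    real_inner_comm d a, real_inner_comm f a, real_inner_comm c b, real_inner_comm d b,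
    real_inner_comm f b, real_inner_comm d c, real_inner_comm f c, real_inner_comm f d,
    h1 a b c d, h1 a b c f, h1 a b d f, h1 a c d f, h1 b c d f,
    h2 a b c d, h2 a b c f, h2 a b d f, h2 a c d f, h2 b c d f,
    h3 a b c d, h3 a b c f, h3 a b d f, h3 a c d f, h3 b c d f]
  ring

theorem dB_eq {σ : ℝ} (hσ : σ = 1 ∨ σ = -1) (a : ZMod 8 → ZMod 7 → ℝ) (x : Fin 5 → E8) :
    dB σ a x = σ * ∑ k : Fin 5, (-1) ^ (k : ℕ) *
      ∑ l, coordForm a l (x k) * chiAlt σ l fun j => x (k.succAbove j) := by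
  simp only [dB, Btensor_eq hσ, Finset.mul_sum, mul_left_comm σ]

theorem dB_of_coordForm {σ : ℝ} (hσ : σ = 1 ∨ σ = -1) {a : ZMod 8 → ZMod 7 → ℝ} {t : E8}
    (h : ∀ (x : E8) (l : ZMod 7), 4 * coordForm a l x = betaPoly σ l x t) (x : Fin 5 → E8) :
    dB σ a x = (dual t ⋏ Phi σ) x := by
  have h4 : 4 * dB σ a x = 4 * (dual t ⋏ Phi σ) x := by
    rw [← sum_chi_succAbove, dB_eq hσ]
    simp only [chi_eq_sum_beta hσ, ← h, Finset.mul_sum]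
    exact Finset.sum_congr rfl fun k _ => Finset.sum_congr rfl fun l _ => by ring
  linarith

theorem coordForm_sub (a b : ZMod 8 → ZMod 7 → ℝ) (l : ZMod 7) (x : Fin 8 → ℝ) :
    coordForm (a - b) l x = coordForm a l x - coordForm b l x := by
  change ∑ i : Fin 8, (a i l - b i l) * x i = _
  simp only [sub_mul, Finset.sum_sub_distrib, coordForm]

theorem dB_sub {σ : ℝ} (hσ : σ = 1 ∨ σ = -1) (a b : ZMod 8 → ZMod 7 → ℝ) (x : Fin 5 → E8) :
    dB σ (a - b) x = dB σ a x - dB σ b x := by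
  simp only [dB_eq hσ, coordForm_sub, sub_mul, Finset.sum_sub_distrib, mul_sub]

theorem coordForm_basisVec (a : ZMod 8 → ZMod 7 → ℝ) (l : ZMod 7) (i : Fin 8) :
    coordForm a l (basisVec i) = a i l := by
  simp only [coordForm, single_ofLp, mul_ite, mul_one, mul_zero, Finset.sum_ite_eq', Finset.mem_univ,
    if_true]

theorem dB_basisVec {s : ℤ} (hs : (s : ℝ) = 1 ∨ (s : ℝ) = -1) (b : ZMod 8 → ZMod 7 → ℝ)
    (i j k m n : Fin 8) :
    dB s b ![basisVec i, basisVec j, basisVec k, basisVec m, basisVec n]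
      = s * ∑ p : Fin 8, ∑ q, b p q * wedgeChiZ s p q i j k m n := by
  have h (g : Fin 8) (l : ZMod 7) (r : ℤ) : b g l * (r : ℝ)
      = ∑ p : Fin 8, b p l * ((if g = p then r else 0 : ℤ) : ℝ) := by
    simp
  rw [dB_eq hs, sum_fin_five_succAbove _ fun (y : E8) w =>
    ∑ l, coordForm b l y * chiAlt s l w]
  simp only [Matrix.cons_val, coordForm_basisVec, chiAlt_basisVec]
  rw [Finset.sum_comm (s := (Finset.univ : Finset (Fin 8)))]
  simp only [← Finset.sum_add_distrib, ← Finset.sum_sub_distrib]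
  congr 1
  refine Finset.sum_congr rfl fun l _ => ?_
  simp only [wedgeChiZ, Int.cast_add, Int.cast_sub, mul_add, mul_sub, Finset.sum_add_distrib,
    Finset.sum_sub_distrib, ← h]

theorem chiSumAt_sum {ι : Type*} [Fintype ι] (σ : ℝ) (l : ZMod 7) (u : ι → ℝ)
    (F : ι → Fin 8 → Fin 8 → Fin 8 → Fin 8 → ℝ) :
    (chiSumAt σ l fun a b c d => ∑ p, u p * F p a b c d) = ∑ p, u p * chiSumAt σ l (F p) := by
  simp only [chiSumAt, chiSum, ← Finset.sum_add_distrib, ← Finset.sum_sub_distrib, smul_eq_mul,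
    Finset.mul_sum]
  exact Finset.sum_congr rfl fun p _ => by ring

/-- The map `a ↦ dB` is injective. -/
theorem eq_zero_of_dB_eq_zero {σ : ℝ} (hσ : σ = 1 ∨ σ = -1) {b : ZMod 8 → ZMod 7 → ℝ}
    (h : ∀ x : Fin 5 → E8, dB σ b x = 0) : b = 0 := by
  obtain ⟨s, hs, rfl⟩ := exists_int_sign hσ
  have hs0 : (s : ℝ) ≠ 0 := by rcases hσ with h | h <;> rw [h] <;> norm_num
  have hw (i j k m n : Fin 8) :
      ∑ r : Fin 8 × ZMod 7, b r.1 r.2 * (wedgeChiZ s r.1 r.2 i j k m n : ℝ) = 0 := by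
    have := h ![basisVec i, basisVec j, basisVec k, basisVec m, basisVec n]
    rw [dB_basisVec hσ] at this
    rw [Fintype.sum_prod_type]
    exact (mul_eq_zero.1 this).resolve_left hs0
  let τ (m : Fin 8) : ℝ := ∑ r : Fin 8 × ZMod 7, b r.1 r.2 * betaZ s r.2 r.1 m
  have hb (i : Fin 8) (l : ZMod 7) : b i l = -∑ m, betaZ s l i m * τ m := by
    have h1 : ∑ r : Fin 8 × ZMod 7, b r.1 r.2 *
        chiSumAt (s : ℝ) l (fun a b c d => (wedgeChiZ s r.1 r.2 i a b c d : ℝ)) = 0 := by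
      rw [← chiSumAt_sum]
      simp only [hw]
      simp [chiSumAt, chiSum]
    have h2 (r : Fin 8 × ZMod 7) :
        chiSumAt (s : ℝ) l (fun a b c d => (wedgeChiZ s r.1 r.2 i a b c d : ℝ))
          = 2 * (if (i, l) = r then 1 else 0) + 2 * ∑ m, (betaZ s l i m * betaZ s r.2 r.1 m : ℝ) := by
      have h3 := chiSumAt_wedgeChiZ s hs i r.1 l r.2
      rw [← Int.cast_inj (α := ℝ)] at h3
      simpa [chiSumAt, chiSum, Prod.ext_iff] using h3
    have h4 : ∑ r : Fin 8 × ZMod 7, b r.1 r.2 * ∑ m, (betaZ s l i m * betaZ s r.2 r.1 m : ℝ)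
        = ∑ m, betaZ s l i m * τ m := by
      simp only [τ, Finset.mul_sum]
      rw [Finset.sum_comm]
      exact Finset.sum_congr rfl fun _ _ => Finset.sum_congr rfl fun _ _ => by ring
    have h5 : ∑ r : Fin 8 × ZMod 7, b r.1 r.2 * (if (i, l) = r then 1 else 0) = b i l := by
      simp
    simp only [h2, mul_add, mul_left_comm _ (2 : ℝ), Finset.sum_add_distrib, ← Finset.mul_sum, h4,
      h5] at h1
    linarith
  have hτ (n : Fin 8) : τ n = 0 := by
    have h1 : τ n = -∑ m, τ m *
        ∑ r : Fin 8 × ZMod 7, (betaZ s r.2 r.1 m * betaZ s r.2 r.1 n : ℝ) := by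
      simp only [Finset.mul_sum]
      rw [Finset.sum_comm, ← Finset.sum_neg_distrib]
      refine Finset.sum_congr rfl fun r _ => ?_
      rw [hb r.1 r.2, neg_mul, Finset.sum_mul]
      exact congrArg _ (Finset.sum_congr rfl fun _ _ => by ring)
    have h2 (m : Fin 8) : ∑ r : Fin 8 × ZMod 7, (betaZ s r.2 r.1 m * betaZ s r.2 r.1 n : ℝ)
        = if m = n then 7 else 0 := by
      have h3 := sum_betaZ_mul_betaZ s hs m n
      rw [← Int.cast_inj (α := ℝ)] at h3
      rw [Fintype.sum_prod_type]
      simpa using h3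
    simp only [h2, mul_ite, mul_zero, Finset.sum_ite_eq', Finset.mem_univ, if_true] at h1
    linarith
  funext i l
  simpa [hτ] using hb i l

theorem coordForm_of_dB {σ : ℝ} (hσ : σ = 1 ∨ σ = -1) {a : ZMod 8 → ZMod 7 → ℝ} {t : E8}
    (h : ∀ x : Fin 5 → E8, dB σ a x = (dual t ⋏ Phi σ) x) (x : E8) (l : ZMod 7) :
    4 * coordForm a l x = betaPoly σ l x t := by
  let a' : ZMod 8 → ZMod 7 → ℝ := fun i l => betaPoly σ l (basisVec (i : Fin 8)) t / 4
  have ha' (x : E8) (l : ZMod 7) : 4 * coordForm a' l x = betaPoly σ l x t := by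
    have h1 (j : Fin 8) : ∑ i : Fin 8, basisVec i j * x i = x j := by
      simp
    simp only [coordForm, a', betaPoly, betaCols, minor2]
    generalize idx l = j0, idx (l + 1) = j1, idx (l + 2) = j2, idx (l + 3) = j3,
      idx (l + 4) = j4, idx (l + 5) = j5, idx (l + 6) = j6
    rw [Finset.mul_sum, ← h1 j0, ← h1 7, ← h1 j1, ← h1 j2, ← h1 j3, ← h1 j4, ← h1 j5, ← h1 j6]
    simp only [Finset.mul_sum, Finset.sum_mul, ← Finset.sum_sub_distrib, ← Finset.sum_add_distrib]
    exact Finset.sum_congr rfl fun i _ => by ring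
  have h0 : a - a' = 0 := eq_zero_of_dB_eq_zero hσ fun y => by
    rw [dB_sub hσ, h, dB_of_coordForm hσ ha', sub_self]
  rw [sub_eq_zero.1 h0, ha']

/-- `dB = θ∧Φ` iff
`4r̄(B)(x,y,z) = ⟨x,y⟩θ(z) − ⟨x,z⟩θ(y) + σΦ(θ♯,x,y,z)` for all `x,y,z`. -/
theorem stmt10 (σ : ℝ) (hσ : σ = 1 ∨ σ = -1) (a : ZMod 8 → ZMod 7 → ℝ) :
    (∀ x : Fin 5 → E8, dB σ a x = (dual (Theta σ a) ⋏ Phi σ) x) ↔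
    (∀ x y z : E8,
      4 * rbar σ (Btensor σ a) x y z
        = ⟪x, y⟫ * ⟪Theta σ a, z⟫ - ⟪x, z⟫ * ⟪Theta σ a, y⟫
          + σ * Phi σ ![Theta σ a, x, y, z]) := by
  rw [rbar_iff hσ]
  exact ⟨coordForm_of_dB hσ, dB_of_coordForm hσ⟩
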